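/- arXiv:2306.05712 — 2 statements merged into one kernel-verified Lean document; each statement's English description precedes it below -/
import Mathlib

section
/- If φ is a solution of the spectral collocation approximation of the elasticity system, then its discrete energy is conserved: E(t) = E(0) for every t ∈ [0,T]. -/
open MeasureTheory Polynomial Finset
open scoped Classical

noncomputable section

/-- Points of `ℝ^d`. -/
abbrev Vec (d : ℕ) := Fin d → ℝ

/-- The open cube `Ω = (-1,1)^d`. -/
def cubeO (d : ℕ) : Set (Vec d) := Set.univ.pi fun _ => Set.Ioo (-1 : ℝ) 1

/-- The closed cube `cl(Ω) = [-1,1]^d`. -/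
def cubeC (d : ℕ) : Set (Vec d) := Set.univ.pi fun _ => Set.Icc (-1 : ℝ) 1

/-- The boundary `∂Ω` of the cube. -/
def cubeB (d : ℕ) : Set (Vec d) := cubeC d \ cubeO d

/-- The Legendre polynomial `L_N` via Rodrigues' formula. -/
def legendre (N : ℕ) : Polynomial ℝ :=
  C (1 / (2 ^ N * (N.factorial : ℝ))) * derivative^[N] ((X ^ 2 - 1) ^ N)

/-- `nd` is the increasing enumeration of the `N+1` Legendre–Gauss–Lobatto nodes,
which are exactly the roots of `(1 - x²) L_N'(x)`. -/
def IsLGL (N : ℕ) (nd : Fin (N + 1) → ℝ) : Prop :=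
  StrictMono nd ∧ nd 0 = -1 ∧ nd (Fin.last N) = 1 ∧
    ∀ x : ℝ, (1 - x ^ 2) * (derivative (legendre N)).eval x = 0 ↔ ∃ k, nd k = x

/-- `Ψ` is the family of Lagrange basis polynomials of degree `N` at the nodes `nd`. -/
def IsLagrange (N : ℕ) (nd : Fin (N + 1) → ℝ) (Ψ : Fin (N + 1) → Polynomial ℝ) : Prop :=
  ∀ k, (Ψ k).natDegree ≤ N ∧ ∀ m, (Ψ k).eval (nd m) = if m = k then 1 else 0

/-- The LGL quadrature weight `ω_k = ∫_{-1}^1 Ψ_k`. -/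
def lglW (N : ℕ) (Ψ : Fin (N + 1) → Polynomial ℝ) (k : Fin (N + 1)) : ℝ :=
  ∫ x in (-1 : ℝ)..(1 : ℝ), (Ψ k).eval x

/-- The tensor-product collocation node `P_i` associated with a multi-index. -/
def nodeP {N d : ℕ} (nd : Fin (N + 1) → ℝ) (k : Fin d → Fin (N + 1)) : Vec d :=
  fun j => nd (k j)

/-- `p : ℝ^d → ℝ` is (the function associated with) a polynomial of degree at most `N`
in each of the `d` variables, i.e. a member of `P_N(Ω)`. -/
def MemPolyN (d N : ℕ) (p : Vec d → ℝ) : Prop :=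
  ∃ q : MvPolynomial (Fin d) ℝ, (∀ j, q.degreeOf j ≤ N) ∧ ∀ x, MvPolynomial.eval x q = p x

/-- Membership in `P_N^{Di}(Ω)`: a polynomial of degree `≤ N` in each variable vanishing
on `∂Ω`. -/
def MemPolyDi (d N : ℕ) (p : Vec d → ℝ) : Prop :=
  MemPolyN d N p ∧ ∀ x ∈ cubeB d, p x = 0

/-- Partial derivative `∂f/∂x_j`. -/
def pd {d : ℕ} (j : Fin d) (f : Vec d → ℝ) (x : Vec d) : ℝ :=
  fderiv ℝ f x (Pi.single j 1)

/-- Divergence of a vector field. -/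
def vdiv {d : ℕ} (v : Vec d → Fin d → ℝ) (x : Vec d) : ℝ :=
  ∑ j, pd j (fun y => v y j) x

/-- The elasticity operator `Δ* = μΔ + (λ+μ)∇div` acting on vector fields. -/
def elast {d : ℕ} (lam mu : ℝ) (v : Vec d → Fin d → ℝ) (x : Vec d) (i : Fin d) : ℝ :=
  mu * ∑ j, pd j (pd j fun y => v y i) x + (lam + mu) * pd i (vdiv v) x

/-- Time derivative of a time-dependent vector field. -/
def tderiv {d : ℕ} (φ : ℝ → Vec d → Fin d → ℝ) : ℝ → Vec d → Fin d → ℝ :=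
  fun t x i => deriv (fun s => φ s x i) t

/-- `φ` is a solution of the spectral collocation approximation of the elasticity system:
`φ ∈ C^∞([0,T]; P_N(Ω)^d)`, `φ_tt(t,P_i) = Δ*φ(t,P_i)` at interior collocation nodes and
`φ(t,P_i) = 0` at boundary collocation nodes. -/
def IsColloc (d N : ℕ) (lam mu T : ℝ) (nd : Fin (N + 1) → ℝ)
    (φ : ℝ → Vec d → Fin d → ℝ) : Prop :=
  (∀ x i, ContDiff ℝ (⊤ : ℕ∞) fun t => φ t x i) ∧
  (∀ t ∈ Set.Icc (0 : ℝ) T, ∀ i, MemPolyN d N fun x => φ t x i) ∧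
  (∀ t ∈ Set.Icc (0 : ℝ) T, ∀ k : Fin d → Fin (N + 1), nodeP nd k ∈ cubeO d →
    ∀ i, tderiv (tderiv φ) t (nodeP nd k) i = elast lam mu (φ t) (nodeP nd k) i) ∧
  (∀ t ∈ Set.Icc (0 : ℝ) T, ∀ k : Fin d → Fin (N + 1), nodeP nd k ∈ cubeB d →
    ∀ i, φ t (nodeP nd k) i = 0)

/-- The discrete (LGL) inner product `(w,z)_N = Σ_i ω_i w(P_i) z(P_i)`. -/
def dInner (N d : ℕ) (nd : Fin (N + 1) → ℝ) (Ψ : Fin (N + 1) → Polynomial ℝ)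
    (w z : Vec d → ℝ) : ℝ :=
  ∑ k : Fin d → Fin (N + 1), (∏ j, lglW N Ψ (k j)) * (w (nodeP nd k) * z (nodeP nd k))

/-- The discrete energy
`E(t) = ½(‖φ_t‖_N² + μ‖∇φ‖_N² + (λ+μ)‖div φ‖_N²)` of a collocation solution. -/
def dEnergy (d N : ℕ) (lam mu : ℝ) (nd : Fin (N + 1) → ℝ) (Ψ : Fin (N + 1) → Polynomial ℝ)
    (φ : ℝ → Vec d → Fin d → ℝ) (t : ℝ) : ℝ :=
  (1 / 2) * ((∑ i, dInner N d nd Ψ (fun x => tderiv φ t x i) fun x => tderiv φ t x i) +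
    mu * ∑ i, ∑ j, dInner N d nd Ψ (pd j fun y => φ t y i) (pd j fun y => φ t y i) +
    (lam + mu) * dInner N d nd Ψ (vdiv (φ t)) (vdiv (φ t)))

/-- Surface integral over the face `{x ∈ ∂Ω : x_j = c}` (with `c = ±1`) of the cube:
the integrand does not depend on the `j`-th variable after the substitution, so the
integral over the full cube divided by `2` is exactly the `(d-1)`-dimensional integral. -/
def faceInt (d : ℕ) (j : Fin d) (c : ℝ) (f : Vec d → ℝ) : ℝ :=
  (1 / 2) * ∫ x in cubeC d, f (Function.update x j c)

/-- The `i`-th component of `μ ∂v/∂ν + (λ+μ) ν div v` on the face with outward normal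
`ν = c·e_j`. -/
def obs1 {d : ℕ} (lam mu : ℝ) (v : Vec d → Fin d → ℝ) (j : Fin d) (c : ℝ) (x : Vec d)
    (i : Fin d) : ℝ :=
  mu * (c * pd j (fun y => v y i) x) +
    (lam + mu) * (c * if i = j then 1 else 0) * vdiv v x

/-- The `i`-th component of `μ ∂²v/∂ν² + (λ+μ) ν ∂(div v)/∂ν` on the face with outward
normal `ν = c·e_j`. -/
def obs2 {d : ℕ} (lam mu : ℝ) (v : Vec d → Fin d → ℝ) (j : Fin d) (c : ℝ) (x : Vec d)
    (i : Fin d) : ℝ :=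
  mu * (c * (c * pd j (pd j fun y => v y i) x)) +
    (lam + mu) * (c * if i = j then 1 else 0) * (c * pd j (vdiv v) x)


lemma intervalIntegral_eval_mul_derivative (p q : ℝ[X]) :
    ∫ x in (-1 : ℝ)..1, p.eval x * (derivative q).eval x =
      p.eval 1 * q.eval 1 - p.eval (-1) * q.eval (-1) -
        ∫ x in (-1 : ℝ)..1, (derivative p).eval x * q.eval x :=
  intervalIntegral.integral_mul_deriv_eq_deriv_mul (fun x _ => p.hasDerivAt x)
    (fun x _ => q.hasDerivAt x) ((derivative p).continuous.intervalIntegrable _ _)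
    ((derivative q).continuous.intervalIntegrable _ _)

lemma eval_iterate_derivative_sq_sub_one_pow {N m : ℕ} (hm : m < N) {x : ℝ} (hx : x ^ 2 = 1) :
    (derivative^[m] ((X ^ 2 - 1 : ℝ[X]) ^ N)).eval x = 0 := by
  obtain ⟨r, hr⟩ := pow_sub_dvd_iterate_derivative_of_pow_dvd (q := (X ^ 2 - 1 : ℝ[X])) m
    (dvd_refl ((X ^ 2 - 1 : ℝ[X]) ^ N))
  simp [hr, hx, Nat.sub_ne_zero_of_lt hm]

lemma intervalIntegral_mul_iterate_derivative_eq_zero {N m : ℕ} (hm : m ≤ N) {s : ℝ[X]}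
    (hs : s.natDegree < m) :
    ∫ x in (-1 : ℝ)..1, s.eval x * (derivative^[m] ((X ^ 2 - 1 : ℝ[X]) ^ N)).eval x = 0 := by
  induction m generalizing s with
  | zero => omega
  | succ m ih =>
    rw [Function.iterate_succ_apply', intervalIntegral_eval_mul_derivative,
      eval_iterate_derivative_sq_sub_one_pow hm (by norm_num),
      eval_iterate_derivative_sq_sub_one_pow hm (by norm_num)]
    by_cases h0 : s.natDegree = 0
    · simp [derivative_of_natDegree_zero h0]
    · have := natDegree_derivative_lt h0
      rw [ih (by omega) (by omega)]
      simp

lemma intervalIntegral_mul_legendre_eq_zero {N : ℕ} {s : ℝ[X]} (hs : s.natDegree < N) :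
    ∫ x in (-1 : ℝ)..1, s.eval x * (legendre N).eval x = 0 := by
  simp only [legendre, eval_mul, eval_C, mul_left_comm (eval _ s)]
  rw [intervalIntegral.integral_const_mul,
    intervalIntegral_mul_iterate_derivative_eq_zero le_rfl hs, mul_zero]

lemma IsLGL.injective {N : ℕ} {nd : Fin (N + 1) → ℝ} (hnd : IsLGL N nd) :
    Function.Injective nd := hnd.1.injective

lemma IsLagrange.eq_sum {N : ℕ} {nd : Fin (N + 1) → ℝ} {Ψ : Fin (N + 1) → ℝ[X]}
    (hinj : Function.Injective nd) (hΨ : IsLagrange N nd Ψ) {p : ℝ[X]} (hp : p.natDegree ≤ N) :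
    p = ∑ k, C (p.eval (nd k)) * Ψ k := by
  refine sub_eq_zero.1 (eq_zero_of_natDegree_lt_card_of_eval_eq_zero _ hinj (fun m => ?_) ?_)
  · simp [eval_finsetSum, (hΨ _).2]
  · rw [Fintype.card_fin, Nat.lt_succ_iff]
    refine (natDegree_sub_le _ _).trans (max_le hp (natDegree_sum_le_of_forall_le _ _ fun k _ => ?_))
    exact (natDegree_C_mul_le _ _).trans (hΨ k).1

lemma lglW_sum_eq_integral_of_natDegree_le {N : ℕ} {nd : Fin (N + 1) → ℝ}
    {Ψ : Fin (N + 1) → ℝ[X]} (hinj : Function.Injective nd) (hΨ : IsLagrange N nd Ψ) {p : ℝ[X]}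
    (hp : p.natDegree ≤ N) :
    ∑ k, lglW N Ψ k * p.eval (nd k) = ∫ x in (-1 : ℝ)..1, p.eval x := by
  conv_rhs => rw [hΨ.eq_sum hinj hp]
  simp only [eval_finsetSum, eval_mul, eval_C]
  rw [intervalIntegral.integral_finsetSum
    fun k _ => ((Ψ k).continuous.const_mul _).intervalIntegrable _ _]
  simp [lglW, mul_comm]

/-- Exactness of the Legendre–Gauss–Lobatto quadrature in degree at most `2N - 1`. -/
lemma lglW_sum_eq_integral {N : ℕ} (hN : 2 ≤ N) {nd : Fin (N + 1) → ℝ} (hnd : IsLGL N nd)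
    {Ψ : Fin (N + 1) → ℝ[X]} (hΨ : IsLagrange N nd Ψ) {r : ℝ[X]} (hr : r.natDegree ≤ 2 * N - 1) :
    ∑ k, lglW N Ψ k * r.eval (nd k) = ∫ x in (-1 : ℝ)..1, r.eval x := by
  set M : ℝ[X] := (1 - X ^ 2) * derivative (legendre N) with hM
  have hroot : ∀ x, M.eval x = 0 ↔ ∃ k, nd k = x := fun x => by
    simpa [hM] using hnd.2.2.2 x
  have hM0 : M ≠ 0 := fun h =>
    (Set.finite_range nd).not_infinite (by
      rw [show Set.range nd = Set.univ from Set.eq_univ_of_forall fun x =>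
        (hroot x).1 (by simp [h])]
      exact Set.infinite_univ)
  have hdeg : N + 1 ≤ M.natDegree := by
    by_contra! h
    exact hM0 (eq_zero_of_natDegree_lt_card_of_eval_eq_zero _ hnd.injective
      (fun k => (hroot _).2 ⟨k, rfl⟩) (by simpa using h))
  have hdegM : M.natDegree ≤ N + 1 := by
    have h1 : (legendre N).natDegree ≤ N := by
      refine (natDegree_C_mul_le _ _).trans ((natDegree_iterate_derivative _ _).trans ?_)
      have : ((X ^ 2 - 1 : ℝ[X]) ^ N).natDegree ≤ N * 2 :=
        natDegree_pow_le_of_le _ (by compute_degree)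
      omega
    have h2 := natDegree_derivative_le (legendre N)
    have h3 : (1 - X ^ 2 : ℝ[X]).natDegree ≤ 2 := by compute_degree
    have : M.natDegree ≤ _ := natDegree_mul_le
    omega
  have hsplit := EuclideanDomain.div_add_mod r M
  have hquot : (r / M).natDegree ≤ N - 2 := by
    by_cases hq : r / M = 0
    · simp [hq]
    have hle : M.degree ≤ r.degree := by
      by_contra! h
      exact hq ((Polynomial.div_eq_zero_iff hM0).2 h)
    have h := natDegree_eq_of_degree_eq ((degree_mul).trans (degree_add_div hM0 hle))
    rw [natDegree_mul hM0 hq] at h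
    omega
  have hrem : (r % M).natDegree ≤ N := by
    have := natDegree_mod_lt r (q := M) (by omega)
    omega
  have hzero : ∫ x in (-1 : ℝ)..1, (M * (r / M)).eval x = 0 := by
    have h := intervalIntegral_eval_mul_derivative ((1 - X ^ 2) * (r / M)) (legendre N)
    rw [intervalIntegral_mul_legendre_eq_zero] at h
    · rw [← sub_eq_zero.2 h]
      simp [hM, mul_right_comm]
    · have h3 : (1 - X ^ 2 : ℝ[X]).natDegree ≤ 2 := by compute_degree
      have h4 := natDegree_mul_le (p := (1 - X ^ 2 : ℝ[X])) (q := r / M)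
      have h5 := natDegree_derivative_le ((1 - X ^ 2) * (r / M))
      omega
  calc ∑ k, lglW N Ψ k * r.eval (nd k) = ∑ k, lglW N Ψ k * (r % M).eval (nd k) := by
        refine sum_congr rfl fun k _ => ?_
        conv_lhs => rw [← hsplit]
        simp [(hroot _).2 ⟨k, rfl⟩]
    _ = ∫ x in (-1 : ℝ)..1, (r % M).eval x :=
        lglW_sum_eq_integral_of_natDegree_le hnd.injective hΨ hrem
    _ = ∫ x in (-1 : ℝ)..1, (M * (r / M) + r % M).eval x := by
        simp only [eval_add]
        rw [intervalIntegral.integral_add ((M * (r / M)).continuous.intervalIntegrable _ _)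
          ((r % M).continuous.intervalIntegrable _ _), hzero, zero_add]
    _ = _ := by rw [hsplit]

/-- The collocation differentiation matrix is skew for the quadrature weights, up to the two
endpoint entries. -/
lemma lglW_mul_derivative_add {N : ℕ} (hN : 2 ≤ N) {nd : Fin (N + 1) → ℝ} (hnd : IsLGL N nd)
    {Ψ : Fin (N + 1) → ℝ[X]} (hΨ : IsLagrange N nd Ψ) (a m : Fin (N + 1)) (h0 : m ≠ 0)
    (h1 : m ≠ Fin.last N) :
    lglW N Ψ a * (derivative (Ψ m)).eval (nd a) = -(lglW N Ψ m * (derivative (Ψ a)).eval (nd m)) := by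
  have hd : (derivative (Ψ a * Ψ m)).natDegree ≤ 2 * N - 1 := by
    have := natDegree_derivative_le (Ψ a * Ψ m)
    have := natDegree_mul_le (p := Ψ a) (q := Ψ m)
    have := (hΨ a).1
    have := (hΨ m).1
    omega
  have h := lglW_sum_eq_integral hN hnd hΨ hd
  have hb := intervalIntegral_eval_mul_derivative 1 (Ψ a * Ψ m)
  have hm1 : (Ψ m).eval 1 = 0 := by
    rw [← hnd.2.2.1, (hΨ m).2, if_neg h1.symm]
  have hm0 : (Ψ m).eval (-1) = 0 := by
    rw [← hnd.2.1, (hΨ m).2, if_neg h0.symm]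
  simp only [eval_one, one_mul, eval_mul, hm1, hm0, mul_zero, derivative_one, eval_zero, zero_mul,
    intervalIntegral.integral_zero, sub_zero] at hb
  rw [hb] at h
  simp only [derivative_mul, eval_add, eval_mul, (hΨ _).2, mul_add, sum_add_distrib, mul_ite,
    ite_mul, mul_one, one_mul, mul_zero, zero_mul, Finset.sum_ite_eq', Finset.mem_univ, if_true] at h
  linarith

/-- Differentiation in the `j`-th variable of grid functions, through the differentiation matrix
of the basis `Ψ`. -/
def gridDeriv {N d : ℕ} (nd : Fin (N + 1) → ℝ) (Ψ : Fin (N + 1) → ℝ[X]) (j : Fin d)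
    (g : (Fin d → Fin (N + 1)) → ℝ) (k : Fin d → Fin (N + 1)) : ℝ :=
  ∑ m, (derivative (Ψ m)).eval (nd (k j)) * g (Function.update k j m)

/-- Discrete integration by parts. -/
lemma sum_mul_gridDeriv {N d : ℕ} (hN : 2 ≤ N) {nd : Fin (N + 1) → ℝ} (hnd : IsLGL N nd)
    {Ψ : Fin (N + 1) → ℝ[X]} (hΨ : IsLagrange N nd Ψ) (j : Fin d)
    (f g : (Fin d → Fin (N + 1)) → ℝ) (hg : ∀ k, k j = 0 ∨ k j = Fin.last N → g k = 0) :
    ∑ k, (∏ i, lglW N Ψ (k i)) * (f k * gridDeriv nd Ψ j g k) =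
      -∑ k, (∏ i, lglW N Ψ (k i)) * (gridDeriv nd Ψ j f k * g k) := by
  simp only [gridDeriv, mul_sum, sum_mul, ← sum_neg_distrib]
  rw [← Fintype.sum_prod_type', ← Fintype.sum_prod_type']
  have hinv : Function.Involutive fun p : (Fin d → Fin (N + 1)) × Fin (N + 1) =>
      (Function.update p.1 j p.2, p.1 j) := fun p => by simp
  refine Fintype.sum_equiv hinv.toPerm _ _ fun ⟨k, m⟩ => ?_
  simp only [Function.Involutive.coe_toPerm, Function.update_self, Function.update_idem,
    Function.update_eq_self]
  by_cases hm : m = 0 ∨ m = Fin.last N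
  · simp [hg (Function.update k j m) (by simpa using hm)]
  · push Not at hm
    have hprod (k : Fin d → Fin (N + 1)) : ∏ i, lglW N Ψ (k i) =
        lglW N Ψ (k j) * ∏ i ∈ univ.erase j, lglW N Ψ (k i) :=
      (mul_prod_erase univ _ (mem_univ j)).symm
    have hupd : ∏ i ∈ univ.erase j, lglW N Ψ (Function.update k j m i) =
        ∏ i ∈ univ.erase j, lglW N Ψ (k i) :=
      prod_congr rfl fun i hi => by rw [Function.update_of_ne (ne_of_mem_erase hi)]
    rw [hprod k, hprod (Function.update k j m), hupd, Function.update_self]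
    linear_combination (∏ i ∈ univ.erase j, lglW N Ψ (k i)) * f k * g (Function.update k j m) *
      lglW_mul_derivative_add hN hnd hΨ (k j) m hm.1 hm.2

lemma MvPolynomial.differentiable_eval {σ : Type*} [Fintype σ] (q : MvPolynomial σ ℝ) :
    Differentiable ℝ fun x : σ → ℝ => MvPolynomial.eval x q := by
  simp only [MvPolynomial.eval_eq']
  fun_prop

lemma pd_eval {d : ℕ} (j : Fin d) (q : MvPolynomial (Fin d) ℝ) (x : Vec d) :
    pd j (fun y => MvPolynomial.eval y q) x = MvPolynomial.eval x (MvPolynomial.pderiv j q) := by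
  induction q using MvPolynomial.induction_on with
  | C a => simp [pd]
  | add p q hp hq =>
    simp only [pd, map_add] at *
    rw [fderiv_fun_add p.differentiable_eval.differentiableAt
      q.differentiable_eval.differentiableAt, _root_.add_apply, hp, hq]
  | mul_X p i hp =>
    simp only [pd, map_mul, MvPolynomial.eval_X, MvPolynomial.pderiv_mul, map_add,
      MvPolynomial.pderiv_X] at *
    rw [fderiv_fun_mul p.differentiable_eval.differentiableAt (by fun_prop)]
    have hproj : fderiv ℝ (fun y : Vec d => y i) x = ContinuousLinearMap.proj i :=
      (ContinuousLinearMap.proj (R := ℝ) (φ := fun _ : Fin d => ℝ) i).fderiv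
    simp only [_root_.add_apply, _root_.smul_apply, smul_eq_mul, hp, hproj,
      ContinuousLinearMap.proj_apply]
    by_cases h : i = j
    · subst h
      simp
      ring
    · simp [h]
      ring

lemma MvPolynomial.degreeOf_pderiv_le {σ R : Type*} [CommSemiring R] (i j : σ)
    (q : MvPolynomial σ R) : (MvPolynomial.pderiv j q).degreeOf i ≤ q.degreeOf i := by
  rw [MvPolynomial.degreeOf_le_iff]
  intro m hm
  rw [MvPolynomial.mem_support_iff, MvPolynomial.coeff_pderiv] at hm
  have := MvPolynomial.monomial_le_degreeOf i
    (MvPolynomial.mem_support_iff.2 (left_ne_zero_of_mul hm))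
  simp only [Finsupp.add_apply] at this
  omega

lemma MemPolyN.pd {d N : ℕ} {p : Vec d → ℝ} (hp : MemPolyN d N p) (j : Fin d) :
    MemPolyN d N (pd j p) := by
  obtain ⟨q, hq, hqp⟩ := hp
  obtain rfl : (fun x => MvPolynomial.eval x q) = p := funext hqp
  exact ⟨_, fun i => (MvPolynomial.degreeOf_pderiv_le i j q).trans (hq i),
    fun x => (pd_eval j q x).symm⟩

lemma MemPolyN.sum {d N : ℕ} {ι : Type*} {s : Finset ι} {p : ι → Vec d → ℝ}
    (hp : ∀ i ∈ s, MemPolyN d N (p i)) : MemPolyN d N fun x => ∑ i ∈ s, p i x := by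
  choose! q hq hqp using hp
  refine ⟨∑ i ∈ s, q i, fun j => ?_, fun x => ?_⟩
  · exact (MvPolynomial.degreeOf_sum_le _ _ _).trans (Finset.sup_le fun i hi => hq i hi j)
  · rw [map_sum]
    exact sum_congr rfl fun i hi => hqp i hi x

/-- The restriction of a member of `P_N(Ω)` to a line parallel to an axis is a polynomial of
degree at most `N`. -/
lemma MemPolyN.exists_eval_eq_update {d N : ℕ} {p : Vec d → ℝ} (hp : MemPolyN d N p) (x : Vec d)
    (j : Fin d) : ∃ r : ℝ[X], r.natDegree ≤ N ∧ ∀ s, r.eval s = p (Function.update x j s) := by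
  obtain ⟨q, hq, hqp⟩ := hp
  refine ⟨∑ m ∈ q.support, C (q.coeff m * ∏ i ∈ univ.erase j, x i ^ m i) * X ^ m j,
    natDegree_sum_le_of_forall_le _ _ fun m hm => ?_, fun s => ?_⟩
  · exact (natDegree_C_mul_X_pow_le _ _).trans
      ((MvPolynomial.monomial_le_degreeOf j hm).trans (hq j))
  · rw [← hqp, MvPolynomial.eval_eq', eval_finsetSum]
    refine sum_congr rfl fun m _ => ?_
    rw [← mul_prod_erase univ _ (mem_univ j), Function.update_self]
    have h : ∏ i ∈ univ.erase j, Function.update x j s i ^ m i = ∏ i ∈ univ.erase j, x i ^ m i :=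
      prod_congr rfl fun i hi => by rw [Function.update_of_ne (ne_of_mem_erase hi)]
    rw [h, eval_mul, eval_C, eval_pow, eval_X]
    ring

lemma MemPolyN.differentiable {d N : ℕ} {p : Vec d → ℝ} (hp : MemPolyN d N p) :
    Differentiable ℝ p := by
  obtain ⟨q, -, hqp⟩ := hp
  obtain rfl : (fun x => MvPolynomial.eval x q) = p := funext hqp
  exact q.differentiable_eval

lemma MemPolyN.pd_nodeP {d N : ℕ} {nd : Fin (N + 1) → ℝ} (hinj : Function.Injective nd)
    {Ψ : Fin (N + 1) → ℝ[X]} (hΨ : IsLagrange N nd Ψ) {p : Vec d → ℝ} (hp : MemPolyN d N p)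
    (j : Fin d) (k : Fin d → Fin (N + 1)) :
    _root_.pd j p (nodeP nd k) = gridDeriv nd Ψ j (fun k => p (nodeP nd k)) k := by
  obtain ⟨r, hr, hrp⟩ := hp.exists_eval_eq_update (nodeP nd k) j
  have h1 : HasDerivAt (fun s => p (Function.update (nodeP nd k) j s))
      (_root_.pd j p (nodeP nd k)) (nd (k j)) := by
    refine HasFDerivAt.comp_hasDerivAt (f := Function.update (nodeP nd k) j) _ ?_
      (hasDerivAt_update _ _ _)
    rw [show Function.update (nodeP nd k) j (nd (k j)) = nodeP nd k from
      Function.update_eq_self j (nodeP nd k)]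
    exact hp.differentiable.differentiableAt.hasFDerivAt
  rw [← funext hrp] at h1
  rw [h1.unique (r.hasDerivAt _), gridDeriv, hΨ.eq_sum hinj hr]
  simp only [derivative_sum, derivative_C_mul, eval_finsetSum, eval_mul, eval_C, hrp]
  refine sum_congr rfl fun m _ => ?_
  rw [mul_comm]
  congr 2
  ext i
  by_cases h : i = j
  · subst h; simp [nodeP]
  · simp [nodeP, h]

lemma nodeP_mem_cubeO_or_cubeB {d N : ℕ} {nd : Fin (N + 1) → ℝ} (hnd : IsLGL N nd)
    (k : Fin d → Fin (N + 1)) : nodeP nd k ∈ cubeO d ∨ nodeP nd k ∈ cubeB d := by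
  refine or_iff_not_imp_left.2 fun h => ⟨fun j _ => ⟨?_, ?_⟩, h⟩
  · rw [← hnd.2.1]
    exact hnd.1.monotone (Fin.zero_le _)
  · rw [← hnd.2.2.1]
    exact hnd.1.monotone (Fin.le_last _)

lemma nodeP_mem_cubeB {d N : ℕ} {nd : Fin (N + 1) → ℝ} (hnd : IsLGL N nd)
    {k : Fin d → Fin (N + 1)} {j : Fin d} (hk : k j = 0 ∨ k j = Fin.last N) :
    nodeP nd k ∈ cubeB d := by
  refine (nodeP_mem_cubeO_or_cubeB hnd k).resolve_left fun h => ?_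
  have hj : nd (k j) ∈ Set.Ioo (-1 : ℝ) 1 := h j (Set.mem_univ j)
  rcases hk with hk | hk
  · exact absurd hj.1 (by rw [hk, hnd.2.1]; exact lt_irrefl _)
  · exact absurd hj.2 (by rw [hk, hnd.2.2.1]; exact lt_irrefl _)

lemma gridDeriv_hasDerivAt {d N : ℕ} {nd : Fin (N + 1) → ℝ} {Ψ : Fin (N + 1) → ℝ[X]}
    {a : ℝ → (Fin d → Fin (N + 1)) → ℝ} {b : (Fin d → Fin (N + 1)) → ℝ} {t : ℝ}
    (h : ∀ k, HasDerivAt (fun s => a s k) (b k) t) (j : Fin d) (k : Fin d → Fin (N + 1)) :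
    HasDerivAt (fun s => gridDeriv nd Ψ j (a s) k) (gridDeriv nd Ψ j b k) t :=
  HasDerivAt.fun_sum fun _ _ => (h _).const_mul _

/-- The discrete energy in terms of the nodal values `a i` of the components of a field and `b i` of
their time derivatives. -/
def gridEnergy {d N : ℕ} (lam mu : ℝ) (nd : Fin (N + 1) → ℝ) (Ψ : Fin (N + 1) → ℝ[X])
    (a b : Fin d → (Fin d → Fin (N + 1)) → ℝ) : ℝ :=
  (1 / 2) * ((∑ i, ∑ k, (∏ l, lglW N Ψ (k l)) * (b i k * b i k)) +
    mu * ∑ i, ∑ j, ∑ k, (∏ l, lglW N Ψ (k l)) *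
      (gridDeriv nd Ψ j (a i) k * gridDeriv nd Ψ j (a i) k) +
    (lam + mu) * ∑ k, (∏ l, lglW N Ψ (k l)) *
      ((∑ j, gridDeriv nd Ψ j (a j) k) * ∑ j, gridDeriv nd Ψ j (a j) k))

lemma hasDerivAt_gridEnergy {d N : ℕ} (lam mu : ℝ) {nd : Fin (N + 1) → ℝ}
    {Ψ : Fin (N + 1) → ℝ[X]} {a b : ℝ → Fin d → (Fin d → Fin (N + 1)) → ℝ}
    {c : Fin d → (Fin d → Fin (N + 1)) → ℝ} {t : ℝ}
    (ha : ∀ i k, HasDerivAt (fun s => a s i k) (b t i k) t)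
    (hb : ∀ i k, HasDerivAt (fun s => b s i k) (c i k) t) :
    HasDerivAt (fun s => gridEnergy lam mu nd Ψ (a s) (b s))
      ((∑ i, ∑ k, (∏ l, lglW N Ψ (k l)) * (c i k * b t i k)) +
        mu * ∑ i, ∑ j, ∑ k, (∏ l, lglW N Ψ (k l)) *
          (gridDeriv nd Ψ j (a t i) k * gridDeriv nd Ψ j (b t i) k) +
        (lam + mu) * ∑ k, (∏ l, lglW N Ψ (k l)) *
          ((∑ j, gridDeriv nd Ψ j (a t j) k) * ∑ j, gridDeriv nd Ψ j (b t j) k)) t := by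
  have hsq {u : ℝ → ℝ} {u' : ℝ} (w : ℝ) (h : HasDerivAt u u' t) :
      HasDerivAt (fun s => w * (u s * u s)) (2 * (w * (u t * u'))) t :=
    ((h.fun_mul h).const_mul w).congr_deriv (by ring)
  have h1 := HasDerivAt.fun_sum (u := univ) fun i _ => HasDerivAt.fun_sum (u := univ) fun k _ =>
    hsq (∏ l, lglW N Ψ (k l)) (hb i k)
  have h2 := HasDerivAt.fun_sum (u := univ) fun i _ => HasDerivAt.fun_sum (u := univ) fun j _ =>
    HasDerivAt.fun_sum (u := univ) fun k _ => hsq (∏ l, lglW N Ψ (k l))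
      (gridDeriv_hasDerivAt (nd := nd) (Ψ := Ψ) (ha i) j k)
  have h3 := HasDerivAt.fun_sum (u := univ) fun k _ => hsq (∏ l, lglW N Ψ (k l))
    (HasDerivAt.fun_sum (u := univ) fun j _ =>
      gridDeriv_hasDerivAt (nd := nd) (Ψ := Ψ) (ha j) j k)
  refine (((h1.fun_add (h2.const_mul mu)).fun_add (h3.const_mul (lam + mu))).const_mul
    (1 / 2)).congr_deriv ?_
  simp only [← mul_sum, mul_comm (c _ _)]
  ring

section Collocation

variable {d N : ℕ} {lam mu T : ℝ} {nd : Fin (N + 1) → ℝ} {Ψ : Fin (N + 1) → ℝ[X]}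
  {φ : ℝ → Vec d → Fin d → ℝ}

lemma MemPolyN.vdiv {v : Vec d → Fin d → ℝ} (hv : ∀ i, MemPolyN d N fun x => v x i) :
    MemPolyN d N (vdiv v) :=
  MemPolyN.sum fun j _ => (hv j).pd j

lemma vdiv_nodeP (hinj : Function.Injective nd) (hΨ : IsLagrange N nd Ψ)
    {v : Vec d → Fin d → ℝ} (hv : ∀ i, MemPolyN d N fun x => v x i) (k : Fin d → Fin (N + 1)) :
    vdiv v (nodeP nd k) = ∑ j, gridDeriv nd Ψ j (fun k => v (nodeP nd k) j) k :=
  sum_congr rfl fun j _ => (hv j).pd_nodeP hinj hΨ j k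

lemma elast_nodeP (hinj : Function.Injective nd) (hΨ : IsLagrange N nd Ψ)
    {v : Vec d → Fin d → ℝ} (hv : ∀ i, MemPolyN d N fun x => v x i) (k : Fin d → Fin (N + 1))
    (i : Fin d) :
    elast lam mu v (nodeP nd k) i =
      mu * ∑ j, gridDeriv nd Ψ j (gridDeriv nd Ψ j fun k => v (nodeP nd k) i) k +
        (lam + mu) *
          gridDeriv nd Ψ i (fun k => ∑ j, gridDeriv nd Ψ j (fun k => v (nodeP nd k) j) k) k := by
  simp only [elast, ((hv i).pd _).pd_nodeP hinj hΨ, (hv i).pd_nodeP hinj hΨ,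
    (MemPolyN.vdiv hv).pd_nodeP hinj hΨ, vdiv_nodeP hinj hΨ hv]

lemma IsColloc.hasDerivAt (hφ : IsColloc d N lam mu T nd φ) (x : Vec d) (i : Fin d) (t : ℝ) :
    HasDerivAt (fun s => φ s x i) (tderiv φ t x i) t :=
  ((hφ.1 x i).differentiable (by simp)).differentiableAt.hasDerivAt

lemma IsColloc.hasDerivAt_tderiv (hφ : IsColloc d N lam mu T nd φ) (x : Vec d) (i : Fin d)
    (t : ℝ) : HasDerivAt (fun s => tderiv φ s x i) (tderiv (tderiv φ) t x i) t :=
  (((hφ.1 x i).iterate_deriv 1).differentiable (by simp)).differentiableAt.hasDerivAt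

lemma IsColloc.tderiv_eq_zero (hT : 0 < T) (hφ : IsColloc d N lam mu T nd φ) {t : ℝ}
    (ht : t ∈ Set.Icc 0 T) {k : Fin d → Fin (N + 1)} (hk : nodeP nd k ∈ cubeB d) (i : Fin d) :
    tderiv φ t (nodeP nd k) i = 0 := by
  have h1 := (hφ.hasDerivAt (nodeP nd k) i t).hasDerivWithinAt (s := Set.Icc 0 T)
  have h2 : HasDerivWithinAt (fun s => φ s (nodeP nd k) i) 0 (Set.Icc 0 T) t :=
    (hasDerivWithinAt_const t _ (0 : ℝ)).congr (fun s hs => hφ.2.2.2 s hs k hk i)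
      (hφ.2.2.2 t ht k hk i)
  exact (uniqueDiffOn_Icc hT t ht).eq_deriv _ h1 h2

lemma IsColloc.dEnergy_eq (hinj : Function.Injective nd) (hΨ : IsLagrange N nd Ψ)
    (hφ : IsColloc d N lam mu T nd φ) {t : ℝ} (ht : t ∈ Set.Icc 0 T) :
    dEnergy d N lam mu nd Ψ φ t =
      gridEnergy lam mu nd Ψ (fun i k => φ t (nodeP nd k) i)
        fun i k => tderiv φ t (nodeP nd k) i := by
  have hp := hφ.2.1 t ht
  simp only [dEnergy, dInner, gridEnergy, vdiv_nodeP hinj hΨ hp, (hp _).pd_nodeP hinj hΨ]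

lemma IsColloc.hasDerivAt_gridEnergy_zero (hN : 2 ≤ N) (hT : 0 < T) (hnd : IsLGL N nd)
    (hΨ : IsLagrange N nd Ψ) (hφ : IsColloc d N lam mu T nd φ) {t : ℝ} (ht : t ∈ Set.Icc 0 T) :
    HasDerivAt (fun s => gridEnergy lam mu nd Ψ (fun i k => φ s (nodeP nd k) i)
      fun i k => tderiv φ s (nodeP nd k) i) 0 t := by
  refine (hasDerivAt_gridEnergy lam mu (a := fun s i k => φ s (nodeP nd k) i)
    (b := fun s i k => tderiv φ s (nodeP nd k) i) (fun i k => hφ.hasDerivAt _ i t)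
    fun i k => hφ.hasDerivAt_tderiv _ i t).congr_deriv ?_
  have hsbp (f : (Fin d → Fin (N + 1)) → ℝ) (i j : Fin d) :=
    sum_mul_gridDeriv hN hnd hΨ j f (fun k => tderiv φ t (nodeP nd k) i)
      fun k hk => hφ.tderiv_eq_zero hT ht (nodeP_mem_cubeB hnd hk) i
  have heq (i : Fin d) (k : Fin d → Fin (N + 1)) :
      tderiv (tderiv φ) t (nodeP nd k) i * tderiv φ t (nodeP nd k) i =
        elast lam mu (φ t) (nodeP nd k) i * tderiv φ t (nodeP nd k) i := by
    rcases nodeP_mem_cubeO_or_cubeB hnd k with hk | hk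
    · rw [hφ.2.2.1 t ht k hk]
    · rw [hφ.tderiv_eq_zero hT ht hk, mul_zero, mul_zero]
  have hdiv (f : (Fin d → Fin (N + 1)) → ℝ) :
      ∑ k, (∏ l, lglW N Ψ (k l)) * (f k *
        ∑ j, gridDeriv nd Ψ j (fun k => tderiv φ t (nodeP nd k) j) k) =
      -∑ j, ∑ k, (∏ l, lglW N Ψ (k l)) * (gridDeriv nd Ψ j f k * tderiv φ t (nodeP nd k) j) := by
    simp only [mul_sum]
    rw [sum_comm, ← sum_neg_distrib]
    exact sum_congr rfl fun j _ => hsbp f j j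
  simp only [heq, elast_nodeP hnd.injective hΨ (hφ.2.1 t ht), hdiv, hsbp]
  have hlap (i : Fin d) :
      ∑ j, ∑ k, (∏ l, lglW N Ψ (k l)) *
        (gridDeriv nd Ψ j (gridDeriv nd Ψ j fun k => φ t (nodeP nd k) i) k *
          tderiv φ t (nodeP nd k) i) =
      ∑ k, (∏ l, lglW N Ψ (k l)) *
        ((∑ j, gridDeriv nd Ψ j (gridDeriv nd Ψ j fun k => φ t (nodeP nd k) i) k) *
          tderiv φ t (nodeP nd k) i) := by
    rw [sum_comm]
    simp only [mul_sum, sum_mul]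
  simp only [sum_neg_distrib, hlap]
  simp only [mul_neg, ← sub_eq_add_neg, mul_sum, ← sum_sub_distrib]
  refine sum_eq_zero fun i _ => ?_
  refine sum_eq_zero fun k _ => ?_
  simp only [← mul_sum]
  ring

end Collocation

/-- Conservation of the discrete energy: `E(t) = E(0)` for every
`t ∈ [0,T]` for any collocation solution `φ`. -/
theorem stmt2 (d N : ℕ) (hd : 2 ≤ d) (hN : 2 ≤ N) (lam mu T : ℝ) (hlam : 0 < lam)
    (hmu : 0 < mu) (hT : 0 < T) (nd : Fin (N + 1) → ℝ) (hnd : IsLGL N nd)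
    (Ψ : Fin (N + 1) → Polynomial ℝ) (hΨ : IsLagrange N nd Ψ)
    (φ : ℝ → Vec d → Fin d → ℝ) (hφ : IsColloc d N lam mu T nd φ) :
    ∀ t ∈ Set.Icc (0 : ℝ) T,
      dEnergy d N lam mu nd Ψ φ t = dEnergy d N lam mu nd Ψ φ 0 := by
  have hconst := constant_of_has_deriv_right_zero
    (fun t ht => (hφ.hasDerivAt_gridEnergy_zero hN hT hnd hΨ ht).continuousAt.continuousWithinAt)
    fun t ht => (hφ.hasDerivAt_gridEnergy_zero hN hT hnd hΨ
      (Set.Ico_subset_Icc_self ht)).hasDerivWithinAt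
  intro t ht
  rw [hφ.dEnergy_eq hnd.injective hΨ ht, hφ.dEnergy_eq hnd.injective hΨ ⟨le_rfl, hT.le⟩]
  exact hconst t ht

end
end

section
/- The Lagrange basis polynomial Ψ_N associated with the endpoint node x^N = 1 of the LGL nodes satisfies ∫_{−1}^{1} Ψ_N(x)² dx ≤ 2/(N(N+1)). -/
open MeasureTheory Polynomial Finset
open scoped Classical

noncomputable section

theorem integral_eval_derivative (p : Polynomial ℝ) (a b : ℝ) :
    ∫ x in a..b, (derivative p).eval x = p.eval b - p.eval a :=
  intervalIntegral.integral_eq_sub_of_hasDerivAt (fun x _ => p.hasDerivAt x)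
    ((derivative p).continuous.intervalIntegrable _ _)

theorem integral_eval_mul_derivative (p q : Polynomial ℝ) (a b : ℝ) :
    ∫ x in a..b, (p * derivative q).eval x =
      (p * q).eval b - (p * q).eval a - ∫ x in a..b, (derivative p * q).eval x := by
  rw [← integral_eval_derivative (p * q), ← intervalIntegral.integral_sub
    ((derivative (p * q)).continuous.intervalIntegrable _ _)
    ((derivative p * q).continuous.intervalIntegrable _ _)]
  simp

theorem eval_iterate_derivative_eq_zero_of_pow_dvd {p : Polynomial ℝ} {r : ℝ} {n k : ℕ}
    (h : (X - C r) ^ n ∣ p) (hk : k < n) : (derivative^[k] p).eval r = 0 := by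
  have h1 := pow_sub_dvd_iterate_derivative_of_pow_dvd k h
  exact dvd_iff_isRoot.1 ((dvd_pow_self _ (by omega)).trans h1)

/-- If all derivatives of `w` of order below `N` vanish at `a` and `b`, then for `k ≤ N` the
`k`-th derivative of `w` is orthogonal on `[a, b]` to the polynomials of degree below `k`. -/
theorem integral_mul_iterate_derivative_eq_zero {w : Polynomial ℝ} {a b : ℝ} {N : ℕ}
    (ha : ∀ j < N, (derivative^[j] w).eval a = 0) (hb : ∀ j < N, (derivative^[j] w).eval b = 0)
    {k : ℕ} (hk : k ≤ N) {q : Polynomial ℝ} (hq : q.degree < k) :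
    ∫ x in a..b, (q * derivative^[k] w).eval x = 0 := by
  induction k generalizing q with
  | zero =>
    have : q = 0 := by simpa using hq
    simp [this]
  | succ k ih =>
    have hd : (derivative q).degree < k := by
      by_cases h0 : q = 0
      · simp [h0]
      · by_cases h1 : derivative q = 0
        · simp [h1]
        · have := degree_derivative_lt h0
          rw [degree_eq_natDegree h1] at this ⊢
          rw [degree_eq_natDegree h0] at this hq
          norm_cast at this hq ⊢
          omega
    rw [Function.iterate_succ_apply', integral_eval_mul_derivative, ih (by omega) hd]
    simp [ha k (by omega), hb k (by omega)]

theorem eval_iterate_derivative_eq_factorial_mul_coeff_taylor (p : Polynomial ℝ) (r : ℝ) (k : ℕ) :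
    (derivative^[k] p).eval r = k.factorial * (taylor r p).coeff k := by
  rw [taylor_coeff, ← factorial_smul_hasseDeriv]
  simp

theorem taylor_one_X_sq_sub_one_pow (N : ℕ) :
    taylor 1 ((X ^ 2 - 1 : Polynomial ℝ) ^ N) = (X + C 2) ^ N * X ^ N := by
  rw [← mul_pow, taylor_pow]
  congr 1
  simp only [map_sub, taylor_pow, taylor_X, taylor_one, map_one]
  rw [show (C 2 : Polynomial ℝ) = 2 from rfl]
  ring

theorem eval_one_legendre (N : ℕ) : (legendre N).eval 1 = 1 := by
  rw [legendre, eval_mul, eval_iterate_derivative_eq_factorial_mul_coeff_taylor,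
    taylor_one_X_sq_sub_one_pow]
  have h := coeff_mul_X_pow ((X + C (2 : ℝ)) ^ N) N 0
  rw [zero_add] at h
  rw [h, coeff_zero_eq_eval_zero]
  simp
  field_simp

theorem eval_one_derivative_legendre (N : ℕ) :
    (derivative (legendre N)).eval 1 = N * (N + 1) / 2 := by
  rw [legendre, derivative_C_mul, eval_mul, ← Function.iterate_succ_apply' derivative,
    eval_iterate_derivative_eq_factorial_mul_coeff_taylor, taylor_one_X_sq_sub_one_pow]
  have h := coeff_mul_X_pow ((X + C (2 : ℝ)) ^ N) N 1
  rw [Nat.add_comm 1 N] at h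
  rw [h, coeff_X_add_C_pow]
  rcases N with _ | n
  · simp
  · rw [Nat.factorial_succ (n + 1)]
    simp
    field_simp
    ring

theorem natDegree_legendre_le (N : ℕ) : (legendre N).natDegree ≤ N := by
  refine (natDegree_C_mul_le _ _).trans ((natDegree_iterate_derivative _ _).trans ?_)
  have h : ((X ^ 2 - 1 : Polynomial ℝ) ^ N).natDegree ≤ N * 2 := by
    refine natDegree_pow_le_of_le N ?_
    compute_degree
  omega

theorem integral_mul_legendre_eq_zero {N : ℕ} {q : Polynomial ℝ} (hq : q.degree < N) :
    ∫ x in (-1 : ℝ)..1, (q * legendre N).eval x = 0 := by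
  have hw : (X ^ 2 - 1 : Polynomial ℝ) ^ N = (X - C 1) ^ N * (X - C (-1)) ^ N := by
    rw [← mul_pow]
    congr 1
    simp only [map_neg, map_one]
    ring
  have h := integral_mul_iterate_derivative_eq_zero (w := (X ^ 2 - 1 : Polynomial ℝ) ^ N)
    (a := -1) (b := 1) (N := N)
    (fun j hj => eval_iterate_derivative_eq_zero_of_pow_dvd (hw ▸ dvd_mul_left _ _) hj)
    (fun j hj => eval_iterate_derivative_eq_zero_of_pow_dvd (hw ▸ dvd_mul_right _ _) hj) le_rfl hq
  simp only [legendre, eval_mul, eval_C] at h ⊢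
  simp_rw [mul_left_comm]
  rw [intervalIntegral.integral_const_mul, h, mul_zero]

theorem degree_derivative_one_add_X_mul_derivative_legendre_lt {N : ℕ} (hN : 1 ≤ N) :
    (derivative ((1 + X) * derivative (legendre N))).degree < N := by
  have h1 : ((1 + X) * derivative (legendre N)).natDegree ≤ N := by
    refine natDegree_mul_le.trans ?_
    have h2 := natDegree_derivative_le (legendre N)
    have h3 := natDegree_legendre_le N
    have h4 : (1 + X : Polynomial ℝ).natDegree ≤ 1 := by compute_degree
    omega
  refine (degree_le_natDegree).trans_lt ?_
  have h5 := natDegree_derivative_le ((1 + X) * derivative (legendre N))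
  norm_cast
  omega

theorem integral_one_add_mul_derivative_legendre_sq {N : ℕ} (hN : 1 ≤ N) :
    ∫ x in (-1 : ℝ)..1, (1 + x) * (derivative (legendre N)).eval x ^ 2 = (N * (N + 1) : ℝ) := by
  have h := integral_eval_mul_derivative ((1 + X) * derivative (legendre N)) (legendre N) (-1) 1
  rw [integral_mul_legendre_eq_zero
    (degree_derivative_one_add_X_mul_derivative_legendre_lt hN)] at h
  simp only [eval_mul, eval_add, eval_one, eval_X, eval_one_legendre,
    eval_one_derivative_legendre] at h
  calc _ = _ := by
        refine intervalIntegral.integral_congr fun x _ => ?_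
        ring
    _ = _ := h
    _ = _ := by ring

theorem IsLagrange.last_eq {N : ℕ} (hN : 1 ≤ N) {nd : Fin (N + 1) → ℝ} (hnd : IsLGL N nd)
    {Ψ : Fin (N + 1) → Polynomial ℝ} (hΨ : IsLagrange N nd Ψ) :
    Ψ (Fin.last N) = C (1 / (N * (N + 1) : ℝ)) * ((1 + X) * derivative (legendre N)) := by
  obtain ⟨hmono, -, hlast, hroot⟩ := hnd
  have hN0 : (N : ℝ) ≠ 0 := by positivity
  refine eq_of_natDegree_lt_card_of_eval_eq _ _ hmono.injective (fun m => ?_) ?_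
  · rw [(hΨ _).2 m]
    simp only [eval_mul, eval_add, eval_one, eval_X, eval_C]
    split_ifs with hm
    · rw [hm, hlast, eval_one_derivative_legendre]
      field_simp
      ring
    · have hne : 1 - nd m ≠ 0 := by
        rw [sub_ne_zero, ← hlast]
        exact fun h => hm (hmono.injective h.symm)
      have h0 := (hroot (nd m)).2 ⟨m, rfl⟩
      have h1 : (1 - nd m) * ((1 + nd m) * (derivative (legendre N)).eval (nd m)) = 0 := by
        linear_combination h0
      rw [(mul_eq_zero.1 h1).resolve_left hne, mul_zero]
  · have h1 := natDegree_C_mul_le (1 / (N * (N + 1) : ℝ)) ((1 + X) * derivative (legendre N))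
    have h2 := natDegree_mul_le (p := (1 + X : Polynomial ℝ)) (q := derivative (legendre N))
    have h3 := natDegree_derivative_le (legendre N)
    have h4 := natDegree_legendre_le N
    have h5 : (1 + X : Polynomial ℝ).natDegree ≤ 1 := by compute_degree
    have h6 := (hΨ (Fin.last N)).1
    rw [Fintype.card_fin]
    omega

/-- The Lagrange basis polynomial at the endpoint node `x^N = 1`
satisfies `∫_{-1}^1 Ψ_N(x)² dx ≤ 2/(N(N+1))`. -/
theorem stmt6 (N : ℕ) (hN : 2 ≤ N) (nd : Fin (N + 1) → ℝ) (hnd : IsLGL N nd)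
    (Ψ : Fin (N + 1) → Polynomial ℝ) (hΨ : IsLagrange N nd Ψ) :
    (∫ x in (-1 : ℝ)..(1 : ℝ), ((Ψ (Fin.last N)).eval x) ^ 2) ≤
      2 / ((N : ℝ) * ((N : ℝ) + 1)) := by
  have hN1 : 1 ≤ N := by omega
  have hN0 : (0 : ℝ) < N := by positivity
  set c : ℝ := 1 / (N * (N + 1)) with hc
  have hle : (∫ x in (-1 : ℝ)..1, ((Ψ (Fin.last N)).eval x) ^ 2) ≤
      ∫ x in (-1 : ℝ)..1, 2 * c ^ 2 * ((1 + x) * (derivative (legendre N)).eval x ^ 2) := by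
    refine intervalIntegral.integral_mono_on (by norm_num)
      (Continuous.intervalIntegrable (by fun_prop) _ _)
      (Continuous.intervalIntegrable (by fun_prop) _ _) fun x hx => ?_
    have hgap : 0 ≤ (1 - x) * (1 + x) * (c * (derivative (legendre N)).eval x) ^ 2 :=
      mul_nonneg (mul_nonneg (by linarith [hx.2]) (by linarith [hx.1])) (sq_nonneg _)
    rw [hΨ.last_eq hN1 hnd]
    simp only [eval_mul, eval_add, eval_one, eval_X, eval_C, ← hc]
    linarith
  refine hle.trans_eq ?_
  rw [intervalIntegral.integral_const_mul, integral_one_add_mul_derivative_legendre_sq hN1, hc]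
  field_simp

end
end
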